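/- arXiv:2109.12325 — 3 statements merged into one kernel-verified Lean document; each statement's English description precedes it below -/
import Mathlib

section
/- Let q₁, …, q_N ∈ ℝ³ be unit vectors, and let R(q) ∈ ℝ^{3N×3N} be the block matrix with blocks R(q)_{ii} = (Σ_{j=i}^N m_j) L_i² I₃ and, for i < j, R(q)_{ij} = (Σ_{k=j}^N m_k) L_i L_j q̂_iᵀ q̂_j and R(q)_{ji} = R(q)_{ij}ᵀ. If ω = (ω₁, …, ω_N) ∈ ℝ^{3N} satisfies ⟨ω_i, q_i⟩ = 0 for all i, then each block component of R(q)ω is again tangent: ⟨(R(q)ω)_i, q_i⟩ = 0 for all i = 1, …, N. -/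
open Matrix

/-- The hat map sending `q ∈ ℝ³` to the skew-symmetric matrix `q̂` with `q̂ x = q × x`. -/
def hat (r : Fin 3 → ℝ) : Matrix (Fin 3) (Fin 3) ℝ :=
  !![0, -r 2, r 1; r 2, 0, -r 0; -r 1, r 0, 0]

/-- The `(i,j)` block of the mass matrix `R(q)` of the N-fold 3D pendulum:
`R(q)_{ii} = (Σ_{j=i}^N m_j) L_i² I₃`, `R(q)_{ij} = (Σ_{k=j}^N m_k) L_i L_j q̂_iᵀ q̂_j`
for `i < j`, and `R(q)_{ji} = R(q)_{ij}ᵀ`. -/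
def massBlock {N : ℕ} (m L : Fin N → ℝ) (q : Fin N → Fin 3 → ℝ) (i j : Fin N) :
    Matrix (Fin 3) (Fin 3) ℝ :=
  if i = j then ((∑ k ∈ Finset.Ici i, m k) * L i ^ 2) • (1 : Matrix (Fin 3) (Fin 3) ℝ)
  else if i < j then ((∑ k ∈ Finset.Ici j, m k) * (L i * L j)) • ((hat (q i))ᵀ * hat (q j))
  else (((∑ k ∈ Finset.Ici i, m k) * (L j * L i)) • ((hat (q j))ᵀ * hat (q i)))ᵀ

/-- The range of `q̂ᵀ` is orthogonal to `q`. -/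
lemma hat_transpose_mulVec_dotProduct_self (r v : Fin 3 → ℝ) :
    ((hat r)ᵀ *ᵥ v) ⬝ᵥ r = 0 := by
  simp [hat, dotProduct, mulVec, Fin.sum_univ_three]
  ring

/-- If every `ω_i` is tangent to the sphere at `q_i`, then each block component of
`R(q)ω` is again tangent: `⟨(R(q)ω)_i, q_i⟩ = 0` for all `i`. -/
theorem massMatrix_preserves_tangency {N : ℕ} (m L : Fin N → ℝ)
    (hm : ∀ i, 0 < m i) (hL : ∀ i, 0 < L i)
    (q : Fin N → Fin 3 → ℝ) (hq : ∀ i, q i ⬝ᵥ q i = 1)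
    (ω : Fin N → Fin 3 → ℝ) (hω : ∀ i, ω i ⬝ᵥ q i = 0) :
    ∀ i, (∑ j, massBlock m L q i j *ᵥ ω j) ⬝ᵥ q i = 0 := by
  intro i
  rw [sum_dotProduct]
  refine Finset.sum_eq_zero fun j _ => ?_
  unfold massBlock
  split_ifs with hij hlt
  · subst hij
    rw [smul_mulVec, one_mulVec, smul_dotProduct, hω, smul_zero]
  · rw [smul_mulVec, smul_dotProduct, ← mulVec_mulVec,
      hat_transpose_mulVec_dotProduct_self, smul_zero]
  · rw [transpose_smul, transpose_mul, smul_mulVec, smul_dotProduct, ← mulVec_mulVec,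
      hat_transpose_mulVec_dotProduct_self, smul_zero]
end

section
/- Let q₁, …, q_N ∈ ℝ³ be unit vectors, m₁, …, m_N > 0, L₁, …, L_N > 0, and let R(q) ∈ ℝ^{3N×3N} be the block matrix with R(q)_{ii} = (Σ_{j=i}^N m_j) L_i² I₃, R(q)_{ij} = (Σ_{k=j}^N m_k) L_i L_j q̂_iᵀ q̂_j for i < j, and R(q)_{ji} = R(q)_{ij}ᵀ. Then R(q) is positive definite on the product of tangent spaces: for every nonzero ω = (ω₁, …, ω_N) ∈ ℝ^{3N} with ⟨ω_i, q_i⟩ = 0 for all i, one has ωᵀ R(q) ω > 0. Consequently, the linear map A_q(ω) := R(q)ω is an invertible map of T_{q₁}S² × ⋯ × T_{q_N}S² onto itself. -/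
open Matrix

/-- The length of link `i` if it lies at or above the mass `k`, and zero otherwise. -/
noncomputable def linkWeight {N : ℕ} (L : Fin N → ℝ) (k i : Fin N) : ℝ :=
  if i ≤ k then L i else 0

lemma hat_mulVec_self (r : Fin 3 → ℝ) : hat r *ᵥ r = 0 := by
  ext a
  fin_cases a <;> simp [hat, mulVec, dotProduct, Fin.sum_univ_three] <;> ring

lemma hat_transpose_mulVec_hat_mulVec {r x : Fin 3 → ℝ} (hr : r ⬝ᵥ r = 1) (hx : r ⬝ᵥ x = 0) :
    (hat r)ᵀ *ᵥ (hat r *ᵥ x) = x := by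
  have triple : (hat r)ᵀ *ᵥ (hat r *ᵥ x) = (r ⬝ᵥ r) • x - (r ⬝ᵥ x) • r := by
    ext a
    fin_cases a <;>
      simp [hat, mulVec, dotProduct, transpose_apply, Fin.sum_univ_three] <;> ring
  rw [triple, hr, hx, one_smul, zero_smul, sub_zero]

lemma sum_mul_linkWeight_mul_linkWeight {N : ℕ} (m L : Fin N → ℝ) (i j : Fin N) :
    ∑ k, m k * (linkWeight L k i * linkWeight L k j) =
      (∑ k ∈ Finset.Ici (max i j), m k) * (L i * L j) := by
  have hIci : Finset.Ici (max i j) = Finset.univ.filter (fun k => i ≤ k ∧ j ≤ k) := by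
    ext k
    simp
  rw [hIci, Finset.sum_filter, Finset.sum_mul]
  refine Finset.sum_congr rfl fun k _ => ?_
  by_cases hi : i ≤ k <;> by_cases hj : j ≤ k <;> simp [linkWeight, hi, hj]

/-- On tangent vectors every block of the mass matrix, diagonal ones included, acts as a multiple
of `q̂_iᵀ q̂_j`. -/
lemma massBlock_mulVec_of_tangent {N : ℕ} (m L : Fin N → ℝ) {q : Fin N → Fin 3 → ℝ}
    (hq : ∀ i, q i ⬝ᵥ q i = 1) (i j : Fin N) {x : Fin 3 → ℝ} (hx : q j ⬝ᵥ x = 0) :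
    massBlock m L q i j *ᵥ x =
      (∑ k, m k * (linkWeight L k i * linkWeight L k j)) •
        ((hat (q i))ᵀ *ᵥ (hat (q j) *ᵥ x)) := by
  rw [sum_mul_linkWeight_mul_linkWeight]
  rcases lt_trichotomy i j with h | rfl | h
  · simp [massBlock, h.ne, h, max_eq_right h.le, smul_mulVec, mulVec_mulVec]
  · simp [massBlock, hat_transpose_mulVec_hat_mulVec (hq i) hx, smul_mulVec, sq]
  · simp [massBlock, h.ne', h.not_gt, max_eq_left h.le, smul_mulVec, mulVec_mulVec,
      transpose_smul, transpose_mul, mul_comm (L i)]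

lemma dotProduct_hat_transpose_mulVec (r x y : Fin 3 → ℝ) :
    x ⬝ᵥ ((hat r)ᵀ *ᵥ y) = (hat r *ᵥ x) ⬝ᵥ y := by
  rw [dotProduct_mulVec, vecMul_transpose]

/-- The quadratic form of the mass matrix is twice the kinetic energy: the sum of the masses
times their squared velocities. -/
lemma massMatrix_quadraticForm {N : ℕ} (m L : Fin N → ℝ) {q : Fin N → Fin 3 → ℝ}
    (hq : ∀ i, q i ⬝ᵥ q i = 1) {ω : Fin N → Fin 3 → ℝ} (hω : ∀ i, q i ⬝ᵥ ω i = 0) :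
    ∑ i, ω i ⬝ᵥ (∑ j, massBlock m L q i j *ᵥ ω j) =
      ∑ k, m k * ((∑ i, linkWeight L k i • (hat (q i) *ᵥ ω i)) ⬝ᵥ
        (∑ i, linkWeight L k i • (hat (q i) *ᵥ ω i))) := by
  simp only [massBlock_mulVec_of_tangent m L hq _ _ (hω _), dotProduct_sum, sum_dotProduct,
    dotProduct_smul, smul_dotProduct, dotProduct_hat_transpose_mulVec, smul_eq_mul,
    Finset.mul_sum, Finset.sum_mul]
  rw [Finset.sum_comm]
  conv_rhs => rw [Finset.sum_comm]
  refine Finset.sum_congr rfl fun j _ => ?_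
  conv_rhs => rw [Finset.sum_comm]
  refine Finset.sum_congr rfl fun i _ => Finset.sum_congr rfl fun k _ => ?_
  ring

lemma eq_zero_of_sum_linkWeight_smul_eq_zero {N : ℕ} {L : Fin N → ℝ} (hL : ∀ i, 0 < L i)
    {u : Fin N → Fin 3 → ℝ} (hu : ∀ k, ∑ i, linkWeight L k i • u i = 0) (k : Fin N) :
    u k = 0 := by
  induction k using WellFoundedLT.induction with
  | ind k ih =>
    have hk := hu k
    rw [Finset.sum_eq_single k] at hk
    · simpa [linkWeight, (hL k).ne'] using hk
    · intro i _ hik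
      rcases lt_or_gt_of_ne hik with h | h
      · rw [ih i h, smul_zero]
      · simp [linkWeight, h.not_ge]
    · simp

lemma massMatrix_quadraticForm_pos {N : ℕ} {m L : Fin N → ℝ}
    (hm : ∀ i, 0 < m i) (hL : ∀ i, 0 < L i)
    {q : Fin N → Fin 3 → ℝ} (hq : ∀ i, q i ⬝ᵥ q i = 1)
    {ω : Fin N → Fin 3 → ℝ} (hω : ∀ i, q i ⬝ᵥ ω i = 0) (hne : ω ≠ 0) :
    0 < ∑ i, ω i ⬝ᵥ (∑ j, massBlock m L q i j *ᵥ ω j) := by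
  rw [massMatrix_quadraticForm m L hq hω]
  have nonneg (v : Fin 3 → ℝ) : 0 ≤ v ⬝ᵥ v := Finset.sum_nonneg fun a _ => mul_self_nonneg (v a)
  have hterm : ∀ k ∈ Finset.univ, 0 ≤ m k * ((∑ i, linkWeight L k i • (hat (q i) *ᵥ ω i)) ⬝ᵥ
      (∑ i, linkWeight L k i • (hat (q i) *ᵥ ω i))) :=
    fun k _ => mul_nonneg (hm k).le (nonneg _)
  refine (Finset.sum_nonneg hterm).lt_of_ne' fun hsum => hne ?_
  have hvel (k : Fin N) : ∑ i, linkWeight L k i • (hat (q i) *ᵥ ω i) = 0 := by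
    have hk := (Finset.sum_eq_zero_iff_of_nonneg hterm).1 hsum k (Finset.mem_univ k)
    exact dotProduct_self_eq_zero.1 ((mul_eq_zero.1 hk).resolve_left (hm k).ne')
  funext i
  have hzero : hat (q i) *ᵥ ω i = 0 :=
    eq_zero_of_sum_linkWeight_smul_eq_zero (u := fun i => hat (q i) *ᵥ ω i) hL hvel i
  rw [← hat_transpose_mulVec_hat_mulVec (hq i) (hω i), hzero, mulVec_zero, Pi.zero_apply]

lemma massMatrix_mulVec_tangent {N : ℕ} (m L : Fin N → ℝ) {q : Fin N → Fin 3 → ℝ}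
    (hq : ∀ i, q i ⬝ᵥ q i = 1) {ω : Fin N → Fin 3 → ℝ} (hω : ∀ i, q i ⬝ᵥ ω i = 0) (i : Fin N) :
    q i ⬝ᵥ (∑ j, massBlock m L q i j *ᵥ ω j) = 0 := by
  simp only [massBlock_mulVec_of_tangent m L hq _ _ (hω _), dotProduct_sum, dotProduct_smul,
    dotProduct_hat_transpose_mulVec, hat_mulVec_self, zero_dotProduct, smul_zero,
    Finset.sum_const_zero]

/-- The product of the tangent spaces `T_{q₁}S² × ⋯ × T_{q_N}S²`. -/
def tangentProduct {N : ℕ} (q : Fin N → Fin 3 → ℝ) : Submodule ℝ (Fin N → Fin 3 → ℝ) where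
  carrier := {ω | ∀ i, q i ⬝ᵥ ω i = 0}
  add_mem' hx hy i := by simp [dotProduct_add, hx i, hy i]
  zero_mem' i := by simp
  smul_mem' c x hx i := by simp [dotProduct_smul, hx i]

/-- The linear map `ω ↦ R(q)ω`. -/
def massMap {N : ℕ} (m L : Fin N → ℝ) (q : Fin N → Fin 3 → ℝ) :
    (Fin N → Fin 3 → ℝ) →ₗ[ℝ] (Fin N → Fin 3 → ℝ) where
  toFun ω i := ∑ j, massBlock m L q i j *ᵥ ω j
  map_add' x y := by
    funext i
    simp [mulVec_add, Finset.sum_add_distrib]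
  map_smul' c x := by
    funext i
    simp [mulVec_smul, Finset.smul_sum]

/-- The mass matrix `R(q)` of the N-fold 3D pendulum is positive definite on the
product of tangent spaces: `ωᵀ R(q) ω > 0` for every nonzero tangent `ω`.
Consequently, the linear map `A_q(ω) := R(q)ω` is an invertible map of
`T_{q₁}S² × ⋯ × T_{q_N}S²` onto itself. -/
theorem massMatrix_positive_definite {N : ℕ} (m L : Fin N → ℝ)
    (hm : ∀ i, 0 < m i) (hL : ∀ i, 0 < L i)
    (q : Fin N → Fin 3 → ℝ) (hq : ∀ i, q i ⬝ᵥ q i = 1) :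
    (∀ ω : Fin N → Fin 3 → ℝ, (∀ i, q i ⬝ᵥ ω i = 0) → ω ≠ 0 →
        0 < ∑ i, ω i ⬝ᵥ (∑ j, massBlock m L q i j *ᵥ ω j)) ∧
    (∀ ω : Fin N → Fin 3 → ℝ, (∀ i, q i ⬝ᵥ ω i = 0) →
        ∀ i, q i ⬝ᵥ (∑ j, massBlock m L q i j *ᵥ ω j) = 0) ∧
    ∀ w : Fin N → Fin 3 → ℝ, (∀ i, q i ⬝ᵥ w i = 0) →
      ∃! ω : Fin N → Fin 3 → ℝ,
        (∀ i, q i ⬝ᵥ ω i = 0) ∧ (fun i => ∑ j, massBlock m L q i j *ᵥ ω j) = w := by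
  refine ⟨fun ω hω hne => massMatrix_quadraticForm_pos hm hL hq hω hne,
    fun ω hω => massMatrix_mulVec_tangent m L hq hω, fun w hw => ?_⟩
  let A : tangentProduct q →ₗ[ℝ] tangentProduct q :=
    (massMap m L q).restrict fun ω hω => massMatrix_mulVec_tangent m L hq hω
  have hinj : Function.Injective A := by
    rw [injective_iff_map_eq_zero]
    intro ω hA
    by_contra hne
    have hpos := massMatrix_quadraticForm_pos hm hL hq ω.2 (by simpa using hne)
    have hzero (i : Fin N) : ∑ j, massBlock m L q i j *ᵥ ω.1 j = 0 :=
      congrFun (congrArg Subtype.val hA) i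
    simp [hzero] at hpos
  obtain ⟨ω, hω⟩ := LinearMap.injective_iff_surjective.1 hinj ⟨w, hw⟩
  refine ⟨ω.1, ⟨ω.2, congrArg Subtype.val hω⟩, fun η hη => ?_⟩
  have heq : A ⟨η, hη.1⟩ = A ω := by
    rw [hω]
    exact Subtype.ext hη.2
  exact congrArg Subtype.val (hinj heq)
end

section
/- The vector field of the N-fold pendulum is generated by the map f : (TS²)^N → 𝔰𝔢(3)^N with components f_i(q, ω) = (ω_i, q_i × h_i(q, ω)): for each i, if |q_i| = 1, ⟨q_i, ω_i⟩ = 0 and ⟨q_i, h_i⟩ = 0, then the infinitesimal generator of the i-th SE(3)-action applied at (q_i, ω_i) with algebra element (ξ, η) = (ω_i, q_i × h_i) equals the pendulum vector field: (ξ × q_i, ξ × ω_i + η × q_i) = (ω_i × q_i, h_i). In particular, (q_i × h_i) × q_i = h_i. -/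
open Matrix

/-- The vector field of the N-fold pendulum is generated by the map
`f : (TS²)^N → 𝔰𝔢(3)^N` with components `f_i(q, ω) = (ω_i, q_i × h_i(q, ω))`:
for each `i`, if `|q_i| = 1`, `⟨q_i, ω_i⟩ = 0` and `⟨q_i, h_i⟩ = 0`, then the
infinitesimal generator `(ξ, η) ↦ (ξ × q_i, ξ × ω_i + η × q_i)` applied with
`(ξ, η) = (ω_i, q_i × h_i)` equals the pendulum vector field `(ω_i × q_i, h_i)`.
In particular, `(q_i × h_i) × q_i = h_i`. -/
theorem pendulum_field_generated (q ω h : Fin 3 → ℝ)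
    (hq : q ⬝ᵥ q = 1) (hω : q ⬝ᵥ ω = 0) (hh : q ⬝ᵥ h = 0) :
    ((crossProduct ω q, crossProduct ω ω + crossProduct (crossProduct q h) q) :
        (Fin 3 → ℝ) × (Fin 3 → ℝ)) = (crossProduct ω q, h) ∧
      crossProduct (crossProduct q h) q = h := by
  have hqh : crossProduct (crossProduct q h) q = h := by
    rw [cross_cross_eq_smul_sub_smul, hq, dotProduct_comm h q, hh, one_smul, zero_smul, sub_zero]
  exact ⟨by rw [cross_self, zero_add, hqh], hqh⟩
end
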